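/- arXiv:1901.01530 — 2 statements merged into one kernel-verified Lean document; each statement's English description precedes it below -/
import Mathlib

section
/- Let w be a smooth function on [−T,T]×ℝ, 2π-periodic in θ, satisfying the Jacobi equation ∂²w/∂s² + ∂²w/∂θ² + 2·cosh(s)^{-2}·w = 0 on (−T,T)×ℝ, and suppose that ∫₀^{2π}∫_{−T}^{T} cosh(s)²·w(s,θ)·φ(s,θ) ds dθ = 0 for each of the three functions φ(s,θ) = cos(θ)/cosh(s), φ(s,θ) = sin(θ)/cosh(s), φ(s,θ) = tanh(s). Then B(w,w) ≥ 0. -/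
/-- The index form of the critical catenoid, for `2π`-periodic functions on `[-T,T] × ℝ`. -/
noncomputable def indexForm (T : ℝ) (u w : ℝ → ℝ → ℝ) : ℝ :=
  (∫ θ in (0:ℝ)..(2 * Real.pi), ∫ s in (-T)..T,
      (deriv (fun s' => u s' θ) s * deriv (fun s' => w s' θ) s
        + deriv (fun θ' => u s θ') θ * deriv (fun θ' => w s θ') θ
        - 2 / (Real.cosh s) ^ 2 * u s θ * w s θ))
  - (1 / T) * ∫ θ in (0:ℝ)..(2 * Real.pi),
      (u T θ * w T θ + u (-T) θ * w (-T) θ)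

open Function

theorem contDiff_deriv_fst {F : ℝ → ℝ → ℝ} (hF : ContDiff ℝ (⊤ : ℕ∞) (uncurry F)) :
    ContDiff ℝ (⊤ : ℕ∞) (uncurry fun s θ => deriv (fun s' => F s' θ) s) := by
  have h : (uncurry fun s θ => deriv (fun s' => F s' θ) s)
      = fun p : ℝ × ℝ => fderiv ℝ (uncurry F) p (1, 0) := by
    funext ⟨s, θ⟩
    have h1 : HasFDerivAt (uncurry F) (fderiv ℝ (uncurry F) (s, θ)) (s, θ) :=
      (hF.differentiable (by simp) _).hasFDerivAt
    have h2 : HasDerivAt (fun s' : ℝ => (s', θ)) ((1, 0) : ℝ × ℝ) s :=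
      (hasDerivAt_id s).prodMk (hasDerivAt_const s θ)
    exact (h1.comp_hasDerivAt s h2).deriv
  rw [h]
  exact (hF.fderiv_right (m := (⊤ : ℕ∞)) (by simp)).clm_apply contDiff_const

theorem contDiff_uncurry_swap {F : ℝ → ℝ → ℝ} (hF : ContDiff ℝ (⊤ : ℕ∞) (uncurry F)) :
    ContDiff ℝ (⊤ : ℕ∞) (uncurry fun θ s => F s θ) :=
  hF.comp (contDiff_snd.prodMk contDiff_fst)

theorem contDiff_deriv_snd {F : ℝ → ℝ → ℝ} (hF : ContDiff ℝ (⊤ : ℕ∞) (uncurry F)) :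
    ContDiff ℝ (⊤ : ℕ∞) (uncurry fun s θ => deriv (fun θ' => F s θ') θ) :=
  contDiff_uncurry_swap (contDiff_deriv_fst (contDiff_uncurry_swap hF))

theorem hasDerivAt_fst {F : ℝ → ℝ → ℝ} (hF : ContDiff ℝ (⊤ : ℕ∞) (uncurry F)) (s θ : ℝ) :
    HasDerivAt (fun s' => F s' θ) (deriv (fun s' => F s' θ) s) s := by
  have : ContDiff ℝ (⊤ : ℕ∞) fun s' => F s' θ := hF.comp (contDiff_id.prodMk contDiff_const)
  exact (this.differentiable (by simp) s).hasDerivAt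

theorem hasDerivAt_snd {F : ℝ → ℝ → ℝ} (hF : ContDiff ℝ (⊤ : ℕ∞) (uncurry F)) (s θ : ℝ) :
    HasDerivAt (fun θ' => F s θ') (deriv (fun θ' => F s θ') θ) θ :=
  hasDerivAt_fst (contDiff_uncurry_swap hF) θ s

theorem continuous_right {F : ℝ → ℝ → ℝ} (hF : ContDiff ℝ (⊤ : ℕ∞) (uncurry F)) (s : ℝ) :
    Continuous (F s) :=
  hF.continuous.comp (Continuous.prodMk_right s)

theorem continuous_left {F : ℝ → ℝ → ℝ} (hF : ContDiff ℝ (⊤ : ℕ∞) (uncurry F)) (θ : ℝ) :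
    Continuous (fun s => F s θ) :=
  continuous_right (contDiff_uncurry_swap hF) θ

theorem hasDerivAt_integral_snd {F : ℝ → ℝ → ℝ} (hF : ContDiff ℝ (⊤ : ℕ∞) (uncurry F))
    (a b s : ℝ) :
    HasDerivAt (fun s => ∫ θ in a..b, F s θ)
      (∫ θ in a..b, deriv (fun s' => F s' θ) s) s := by
  have hF' := contDiff_deriv_fst hF
  obtain ⟨C, hC⟩ := ((isCompact_Icc (a := s - 1) (b := s + 1)).prod
    (isCompact_uIcc (a := a) (b := b))).exists_bound_of_continuousOn hF'.continuous.continuousOn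
  refine (intervalIntegral.hasDerivAt_integral_of_dominated_loc_of_deriv_le
    (F := F) (F' := fun s θ => deriv (fun s' => F s' θ) s) (bound := fun _ => C)
    (Icc_mem_nhds (sub_one_lt s) (lt_add_one s))
    (.of_forall fun x => (continuous_right hF x).aestronglyMeasurable)
    ((continuous_right hF s).intervalIntegrable _ _)
    (continuous_right hF' s).aestronglyMeasurable
    (.of_forall fun θ hθ x hx => hC (x, θ) ⟨hx, Set.uIoc_subset_uIcc hθ⟩)
    intervalIntegrable_const
    (.of_forall fun θ _ x _ => hasDerivAt_fst hF x θ)).2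

theorem hasDerivAt_tanh (s : ℝ) : HasDerivAt Real.tanh (1 / Real.cosh s ^ 2) s := by
  have h : Real.tanh = fun s => Real.sinh s / Real.cosh s := by
    funext s; exact Real.tanh_eq_sinh_div_cosh s
  rw [h]
  refine ((Real.hasDerivAt_sinh s).div (Real.hasDerivAt_cosh s)
    (Real.cosh_pos s).ne').congr_deriv ?_
  rw [← Real.cosh_sq_sub_sinh_sq s]
  ring

/-- A Jacobi mode of frequency `n` with `n² ≥ 4` has nonnegative boundary form. -/
theorem boundary_nonneg_of_two_le {T : ℝ} (hT : 0 < T) (hTt : T * Real.tanh T = 1) {n : ℝ}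
    (hn : 4 ≤ n ^ 2) {f f' : ℝ → ℝ} (hf : ∀ s, HasDerivAt f (f' s) s)
    (hf' : ∀ s ∈ Set.Icc (-T) T, HasDerivAt f' ((n ^ 2 - 2 / Real.cosh s ^ 2) * f s) s) :
    0 ≤ f T * f' T - f (-T) * f' (-T) - 1 / T * (f T ^ 2 + f (-T) ^ 2) := by
  have hD : ∀ s ∈ Set.Icc (-T) T,
      HasDerivAt (fun s => f s * f' s - 2 * Real.tanh s * f s ^ 2)
        ((f' s - 2 * Real.tanh s * f s) ^ 2 + (n ^ 2 - 4) * f s ^ 2) s := by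
    intro s hs
    refine (((hf s).mul (hf' s hs)).sub
      (((hasDerivAt_tanh s).const_mul 2).mul ((hf s).pow 2))).congr_deriv ?_
    have := (Real.cosh_pos s).ne'
    rw [Real.tanh_eq_sinh_div_cosh]
    field_simp
    simp
    linear_combination 4 * f s ^ 2 * Real.cosh_sq s
  have hmono : MonotoneOn (fun s => f s * f' s - 2 * Real.tanh s * f s ^ 2) (Set.Icc (-T) T) := by
    refine monotoneOn_of_deriv_nonneg (convex_Icc _ _)
      (fun s hs => (hD s hs).continuousAt.continuousWithinAt)
      (fun s hs => (hD s (interior_subset hs)).differentiableAt.differentiableWithinAt) ?_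
    intro s hs
    rw [(hD s (interior_subset hs)).deriv]
    have : 0 ≤ n ^ 2 - 4 := by linarith
    positivity
  have h := hmono (Set.left_mem_Icc.2 (by linarith)) (Set.right_mem_Icc.2 (by linarith))
    (by linarith)
  simp only [Real.tanh_neg] at h
  have hinv : Real.tanh T = 1 / T := by field_simp; linarith
  rw [hinv] at h
  have h2 : 0 ≤ 1 / T * (f T ^ 2 + f (-T) ^ 2) := by positivity
  linarith

/-- A solution of a second order linear equation is a combination of two solutions with constant nonzero Wronskian. -/
theorem exists_eq_combination {T c : ℝ} (hc : c ≠ 0) {q f f' u u' v v' : ℝ → ℝ}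
    (hf : ∀ s, HasDerivAt f (f' s) s)
    (hf' : ∀ s ∈ Set.Icc (-T) T, HasDerivAt f' (q s * f s) s)
    (hu : ∀ s, HasDerivAt u (u' s) s) (hu' : ∀ s, HasDerivAt u' (q s * u s) s)
    (hv : ∀ s, HasDerivAt v (v' s) s) (hv' : ∀ s, HasDerivAt v' (q s * v s) s)
    (hW : ∀ s, u s * v' s - u' s * v s = c) :
    ∃ α β : ℝ, ∀ s ∈ Set.Icc (-T) T,
      f s = α * u s + β * v s ∧ f' s = α * u' s + β * v' s := by
  have key : ∀ g g' : ℝ → ℝ, (∀ s, HasDerivAt g (g' s) s) → (∀ s, HasDerivAt g' (q s * g s) s) →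
      ∀ s ∈ Set.Icc (-T) T, f s * g' s - f' s * g s = f (-T) * g' (-T) - f' (-T) * g (-T) := by
    intro g g' hg hg'
    have hD : ∀ s ∈ Set.Icc (-T) T, HasDerivAt (fun s => f s * g' s - f' s * g s) 0 s := by
      intro s hs
      exact (((hf s).mul (hg' s)).sub ((hf' s hs).mul (hg s))).congr_deriv (by ring)
    exact constant_of_has_deriv_right_zero
      (fun s hs => (hD s hs).continuousAt.continuousWithinAt)
      (fun s hs => (hD s (Set.Ico_subset_Icc_self hs)).hasDerivWithinAt)
  refine ⟨(f (-T) * v' (-T) - f' (-T) * v (-T)) / c, -(f (-T) * u' (-T) - f' (-T) * u (-T)) / c,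
    fun s hs => ?_⟩
  rw [← key v v' hv hv' s hs, ← key u u' hu hu' s hs]
  have := hW s
  constructor
  · field_simp
    rw [← this]; ring
  · field_simp
    rw [← this]; ring

theorem intervalIntegral_eq_zero_of_odd {g : ℝ → ℝ} (hg : ∀ s, g (-s) = -g s) (T : ℝ) :
    ∫ s in (-T)..T, g s = 0 := by
  have h := intervalIntegral.integral_comp_neg (a := -T) (b := T) g
  simp only [hg, neg_neg, intervalIntegral.integral_neg] at h
  linarith

theorem exists_eq_smul_of_orthogonal {T c : ℝ} (hT : 0 < T) (hc : c ≠ 0)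
    {q k f f' u u' v v' : ℝ → ℝ}
    (hf : ∀ s, HasDerivAt f (f' s) s)
    (hf' : ∀ s ∈ Set.Icc (-T) T, HasDerivAt f' (q s * f s) s)
    (hu : ∀ s, HasDerivAt u (u' s) s) (hu' : ∀ s, HasDerivAt u' (q s * u s) s)
    (hv : ∀ s, HasDerivAt v (v' s) s) (hv' : ∀ s, HasDerivAt v' (q s * v s) s)
    (hW : ∀ s, u s * v' s - u' s * v s = c)
    (hk : Continuous k) (hku : 0 < ∫ s in (-T)..T, k s * u s)
    (hkv : ∀ s, k (-s) * v (-s) = -(k s * v s))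
    (horth : ∫ s in (-T)..T, k s * f s = 0) :
    ∃ β : ℝ, ∀ s ∈ Set.Icc (-T) T, f s = β * v s ∧ f' s = β * v' s := by
  obtain ⟨α, β, h⟩ := exists_eq_combination hc hf hf' hu hu' hv hv' hW
  have hcu : Continuous u := continuous_iff_continuousAt.2 fun s => (hu s).continuousAt
  have hcv : Continuous v := continuous_iff_continuousAt.2 fun s => (hv s).continuousAt
  have hα : α = 0 := by
    have h1 : ∫ s in (-T)..T, k s * f s
        = ∫ s in (-T)..T, (α * (k s * u s) + β * (k s * v s)) := by
      refine intervalIntegral.integral_congr fun s hs => ?_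
      rw [Set.uIcc_of_le (by linarith)] at hs
      simp only [(h s hs).1]
      ring
    rw [horth, intervalIntegral.integral_add
      (Continuous.intervalIntegrable (by fun_prop) _ _)
      (Continuous.intervalIntegrable (by fun_prop) _ _),
      intervalIntegral.integral_const_mul, intervalIntegral.integral_const_mul,
      intervalIntegral_eq_zero_of_odd (g := fun s => k s * v s) hkv, mul_zero, add_zero] at h1
    exact (mul_eq_zero.1 h1.symm).resolve_right hku.ne'
  exact ⟨β, fun s hs => by simpa [hα] using h s hs⟩

theorem hasDerivAt_inv_cosh (s : ℝ) :
    HasDerivAt (fun s => 1 / Real.cosh s) (-(Real.sinh s / Real.cosh s ^ 2)) s := by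
  refine ((hasDerivAt_const s (1 : ℝ)).div (Real.hasDerivAt_cosh s)
    (Real.cosh_pos s).ne').congr_deriv ?_
  ring

theorem hasDerivAt_inv_cosh_sq (s : ℝ) :
    HasDerivAt (fun s => 1 / Real.cosh s ^ 2) (-(2 * Real.sinh s / Real.cosh s ^ 3)) s := by
  have := (Real.cosh_pos s).ne'
  refine ((hasDerivAt_const s (1 : ℝ)).div ((Real.hasDerivAt_cosh s).pow 2)
    (pow_ne_zero 2 this)).congr_deriv ?_
  simp
  field_simp

theorem boundary_nonneg_of_zero {T : ℝ} (hT : 0 < T) (hTt : T * Real.tanh T = 1)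
    {f f' : ℝ → ℝ} (hf : ∀ s, HasDerivAt f (f' s) s)
    (hf' : ∀ s ∈ Set.Icc (-T) T, HasDerivAt f' (-(2 / Real.cosh s ^ 2) * f s) s)
    (horth : ∫ s in (-T)..T, Real.cosh s ^ 2 * Real.tanh s * f s = 0) :
    0 ≤ f T * f' T - f (-T) * f' (-T) - 1 / T * (f T ^ 2 + f (-T) ^ 2) := by
  have hsech := hasDerivAt_inv_cosh_sq
  have hct : Continuous Real.tanh :=
    continuous_iff_continuousAt.2 fun s => (hasDerivAt_tanh s).continuousAt
  obtain ⟨β, h⟩ := exists_eq_smul_of_orthogonal (q := fun s => -(2 / Real.cosh s ^ 2))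
    (k := fun s => Real.cosh s ^ 2 * Real.tanh s)
    (u := Real.tanh) (u' := fun s => 1 / Real.cosh s ^ 2)
    (v := fun s => 1 - s * Real.tanh s) (v' := fun s => -(Real.tanh s + s * (1 / Real.cosh s ^ 2)))
    (c := -1) hT (by norm_num) hf hf' hasDerivAt_tanh
    (fun s => (hsech s).congr_deriv (by
      have := (Real.cosh_pos s).ne'
      rw [Real.tanh_eq_sinh_div_cosh]; field_simp))
    (fun s => ((hasDerivAt_const s (1 : ℝ)).sub
      ((hasDerivAt_id s).mul (hasDerivAt_tanh s))).congr_deriv (by simp))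
    (fun s => ((hasDerivAt_tanh s).add
      ((hasDerivAt_id s).mul (hsech s))).neg.congr_deriv (by
        have := (Real.cosh_pos s).ne'
        rw [Real.tanh_eq_sinh_div_cosh]; simp; field_simp; ring))
    (fun s => by
      have := (Real.cosh_pos s).ne'
      have h2 := Real.cosh_sq s
      rw [Real.tanh_eq_sinh_div_cosh]; field_simp
      linear_combination Real.cosh s * h2)
    (by fun_prop)
    (by
      refine intervalIntegral.integral_pos (by linarith)
        (Continuous.continuousOn (by fun_prop)) (fun s _ => ?_) ⟨T, ⟨by linarith, le_rfl⟩, ?_⟩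
      · rw [mul_assoc]
        exact mul_nonneg (sq_nonneg _) (mul_self_nonneg _)
      · have ht : 0 < Real.tanh T := pos_of_mul_pos_right (hTt ▸ one_pos) hT.le
        have := Real.cosh_pos T
        positivity)
    (fun s => by simp)
    horth
  have h1 := h T ⟨by linarith, le_rfl⟩
  have h2 := h (-T) ⟨le_rfl, by linarith⟩
  have h0 : 1 - T * Real.tanh T = 0 := by linarith
  simp only [Real.tanh_neg, neg_mul_neg, h0, mul_zero] at h1 h2
  simp [h1.1, h2.1]

theorem boundary_nonneg_of_one {T : ℝ} (hT : 0 < T) (hTt : T * Real.tanh T = 1)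
    {f f' : ℝ → ℝ} (hf : ∀ s, HasDerivAt f (f' s) s)
    (hf' : ∀ s ∈ Set.Icc (-T) T, HasDerivAt f' ((1 - 2 / Real.cosh s ^ 2) * f s) s)
    (horth : ∫ s in (-T)..T, Real.cosh s * f s = 0) :
    0 ≤ f T * f' T - f (-T) * f' (-T) - 1 / T * (f T ^ 2 + f (-T) ^ 2) := by
  have hsech := hasDerivAt_inv_cosh
  obtain ⟨β, h⟩ := exists_eq_smul_of_orthogonal (q := fun s => 1 - 2 / Real.cosh s ^ 2)
    (k := Real.cosh)
    (u := fun s => 1 / Real.cosh s) (u' := fun s => -(Real.sinh s / Real.cosh s ^ 2))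
    (v := fun s => Real.sinh s + s * (1 / Real.cosh s))
    (v' := fun s => Real.cosh s + (1 / Real.cosh s + s * -(Real.sinh s / Real.cosh s ^ 2)))
    (c := 2) hT (by norm_num) hf hf' hsech
    (fun s => by
      have := (Real.cosh_pos s).ne'
      refine ((Real.hasDerivAt_sinh s).div ((Real.hasDerivAt_cosh s).pow 2)
        (pow_ne_zero 2 this)).neg.congr_deriv ?_
      have h2 := Real.sinh_sq s
      simp
      field_simp
      rw [h2]; ring)
    (fun s => ((Real.hasDerivAt_sinh s).add
      ((hasDerivAt_id s).mul (hsech s))).congr_deriv (by simp))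
    (fun s => by
      have := (Real.cosh_pos s).ne'
      refine ((Real.hasDerivAt_cosh s).add ((hsech s).add
        ((hasDerivAt_id s).mul ((Real.hasDerivAt_sinh s).div ((Real.hasDerivAt_cosh s).pow 2)
        (pow_ne_zero 2 this)).neg))).congr_deriv ?_
      have h2 := Real.sinh_sq s
      simp
      field_simp
      ring_nf
      simp only [h2]; ring)
    (fun s => by
      have := (Real.cosh_pos s).ne'
      have h2 := Real.sinh_sq s
      field_simp
      ring_nf
      simp only [h2]; ring)
    (by fun_prop)
    (by
      refine intervalIntegral.intervalIntegral_pos_of_pos (Continuous.intervalIntegrable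
        (Real.continuous_cosh.mul (continuous_const.div Real.continuous_cosh
          fun s => (Real.cosh_pos s).ne')) _ _) ?_ (by linarith)
      intro s
      have := Real.cosh_pos s
      positivity)
    (fun s => by simp; ring)
    horth
  have h1 := h T ⟨by linarith, le_rfl⟩
  have h2 := h (-T) ⟨le_rfl, by linarith⟩
  rw [h1.1, h1.2, h2.1, h2.2]
  simp only [Real.sinh_neg, Real.cosh_neg]
  have hc := (Real.cosh_pos T).ne'
  rw [Real.tanh_eq_sinh_div_cosh] at hTt
  have hTs : T * Real.sinh T = Real.cosh T := by field_simp at hTt; linarith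
  have h3 : Real.cosh T + (1 / Real.cosh T + T * -(Real.sinh T / Real.cosh T ^ 2))
      = Real.cosh T := by
    field_simp; rw [hTs]; ring
  have h5 : Real.cosh T + (1 / Real.cosh T + -T * -(-Real.sinh T / Real.cosh T ^ 2))
      = Real.cosh T := by
    field_simp; rw [hTs]; ring
  have h6 : Real.sinh T + T * (1 / Real.cosh T) = T * Real.cosh T := by
    have h7 := Real.cosh_sq T
    field_simp
    rw [h7]
    linear_combination -(Real.sinh T) * hTs
  have h7 : -Real.sinh T + -T * (1 / Real.cosh T) = -(T * Real.cosh T) := by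
    linear_combination -h6
  rw [h3, h5, h6, h7]
  apply le_of_eq
  field_simp
  ring

theorem integral_fourier_neg_smul {f : ℝ → ℝ} (hf : Continuous f) (n : ℤ) :
    ∫ x in (0 : ℝ)..(2 * Real.pi),
        fourier (-n) (x : AddCircle (2 * Real.pi - 0)) • (f x : ℂ)
      = ((∫ x in (0 : ℝ)..(2 * Real.pi), f x * Real.cos (n * x) : ℝ) : ℂ)
        - ((∫ x in (0 : ℝ)..(2 * Real.pi), f x * Real.sin (n * x) : ℝ) : ℂ) * Complex.I := by
  rw [← intervalIntegral.integral_ofReal, ← intervalIntegral.integral_ofReal,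
    ← intervalIntegral.integral_mul_const, ← intervalIntegral.integral_sub
      (Continuous.intervalIntegrable (by fun_prop) _ _)
      (Continuous.intervalIntegrable (by fun_prop) _ _)]
  refine intervalIntegral.integral_congr fun x _ => ?_
  have hpi : (Real.pi : ℂ) ≠ 0 := by exact_mod_cast Real.pi_ne_zero
  have : 2 * (Real.pi : ℂ) * Complex.I * ((-n : ℤ) : ℂ) * x / ((2 * Real.pi - 0 : ℝ) : ℂ)
      = (-(n * x : ℂ)) * Complex.I := by
    push_cast
    field_simp
    ring
  simp only [fourier_coe_apply, this, Complex.exp_mul_I, smul_eq_mul, Complex.cos_neg,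
    Complex.sin_neg]
  push_cast
  ring

theorem hasSum_sq_cos_sin {f : ℝ → ℝ} (hf : Continuous f) :
    HasSum (fun n : ℤ => (∫ x in (0 : ℝ)..(2 * Real.pi), f x * Real.cos (n * x)) ^ 2
        + (∫ x in (0 : ℝ)..(2 * Real.pi), f x * Real.sin (n * x)) ^ 2)
      (2 * Real.pi * ∫ x in (0 : ℝ)..(2 * Real.pi), f x ^ 2) := by
  have hpi := Real.pi_pos
  have hL2 : MeasureTheory.MemLp (fun x => (f x : ℂ)) 2
      (MeasureTheory.volume.restrict (Set.Ioc 0 (2 * Real.pi))) := by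
    have hc : Continuous fun x => (f x : ℂ) := by fun_prop
    obtain ⟨C, hC⟩ := (isCompact_Icc (a := (0 : ℝ)) (b := 2 * Real.pi)).exists_bound_of_continuousOn
      hc.continuousOn
    refine MeasureTheory.MemLp.of_bound hc.aestronglyMeasurable C ?_
    refine (MeasureTheory.ae_restrict_iff' measurableSet_Ioc).2 (.of_forall fun x hx => ?_)
    exact hC x (Set.Ioc_subset_Icc_self hx)
  have h := (hasSum_sq_fourierCoeffOn Real.two_pi_pos hL2).mul_left ((2 * Real.pi) ^ 2)
  simp only [fourierCoeffOn_eq_integral, integral_fourier_neg_smul hf] at h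
  have hval : (2 * Real.pi) ^ 2 * (2 * Real.pi - 0)⁻¹ •
      ∫ x in (0 : ℝ)..(2 * Real.pi), ‖(f x : ℂ)‖ ^ 2
      = 2 * Real.pi * ∫ x in (0 : ℝ)..(2 * Real.pi), f x ^ 2 := by
    simp only [Complex.norm_real, Real.norm_eq_abs, sq_abs, sub_zero, smul_eq_mul]
    field_simp
  rw [hval] at h
  refine (congrArg (fun F => HasSum F _) (funext fun n => ?_)).mp h
  rw [sub_zero, norm_smul, mul_pow ‖_‖, ← Complex.normSq_eq_norm_sq, sub_eq_add_neg, ← neg_mul,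
    ← Complex.ofReal_neg, Complex.normSq_add_mul_I, Real.norm_eq_abs, sq_abs]
  field_simp

/-- Parseval's identity for the real Fourier coefficients. -/
theorem hasSum_mul_cos_sin {f g : ℝ → ℝ} (hf : Continuous f) (hg : Continuous g) :
    HasSum (fun n : ℤ =>
        (∫ x in (0 : ℝ)..(2 * Real.pi), f x * Real.cos (n * x))
          * (∫ x in (0 : ℝ)..(2 * Real.pi), g x * Real.cos (n * x))
        + (∫ x in (0 : ℝ)..(2 * Real.pi), f x * Real.sin (n * x))
          * (∫ x in (0 : ℝ)..(2 * Real.pi), g x * Real.sin (n * x)))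
      (2 * Real.pi * ∫ x in (0 : ℝ)..(2 * Real.pi), f x * g x) := by
  have h := (((hasSum_sq_cos_sin (hf.add hg)).sub (hasSum_sq_cos_sin hf)).sub
    (hasSum_sq_cos_sin hg)).div_const 2
  have hadd (e : ℝ → ℝ) (he : Continuous e) : ∫ x in (0 : ℝ)..(2 * Real.pi), (f x + g x) * e x
      = (∫ x in (0 : ℝ)..(2 * Real.pi), f x * e x) + ∫ x in (0 : ℝ)..(2 * Real.pi), g x * e x := by
    rw [← intervalIntegral.integral_add
      (Continuous.intervalIntegrable (by fun_prop) _ _)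
      (Continuous.intervalIntegrable (by fun_prop) _ _)]
    exact intervalIntegral.integral_congr fun x _ => by ring
  have hsq : ∫ x in (0 : ℝ)..(2 * Real.pi), (f x + g x) ^ 2
      = (∫ x in (0 : ℝ)..(2 * Real.pi), f x ^ 2) + (∫ x in (0 : ℝ)..(2 * Real.pi), g x ^ 2)
        + 2 * ∫ x in (0 : ℝ)..(2 * Real.pi), f x * g x := by
    rw [← intervalIntegral.integral_const_mul, ← intervalIntegral.integral_add
      (Continuous.intervalIntegrable (by fun_prop) _ _)
      (Continuous.intervalIntegrable (by fun_prop) _ _), ← intervalIntegral.integral_add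
      (Continuous.intervalIntegrable (by fun_prop) _ _)
      (Continuous.intervalIntegrable (by fun_prop) _ _)]
    exact intervalIntegral.integral_congr fun x _ => by ring
  simp only [Pi.add_apply, hsq] at h
  have hval (p q r : ℝ) : (2 * Real.pi * (p + q + 2 * r) - 2 * Real.pi * p - 2 * Real.pi * q) / 2
      = 2 * Real.pi * r := by ring
  rw [hval] at h
  refine (congrArg (fun F => HasSum F _) (funext fun n => ?_)).mp h
  rw [hadd _ (by fun_prop), hadd _ (by fun_prop)]
  ring

theorem integral_eq_zero_of_hasDerivAt_periodic {h h' : ℝ → ℝ} {P : ℝ}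
    (hd : ∀ θ, HasDerivAt h (h' θ) θ) (hc : Continuous h') (hper : h P = h 0) :
    ∫ θ in (0 : ℝ)..P, h' θ = 0 := by
  rw [intervalIntegral.integral_eq_sub_of_hasDerivAt (fun θ _ => hd θ)
    (hc.intervalIntegrable _ _), hper, sub_self]

theorem jacobi_eq_on_Icc {T : ℝ} (hT : 0 < T) {w : ℝ → ℝ → ℝ}
    (hw : ContDiff ℝ (⊤ : ℕ∞) (uncurry w))
    (hj : ∀ s ∈ Set.Ioo (-T) T, ∀ θ : ℝ,
      iteratedDeriv 2 (fun s' => w s' θ) s + iteratedDeriv 2 (fun θ' => w s θ') θ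
        + 2 / (Real.cosh s) ^ 2 * w s θ = 0) :
    ∀ s ∈ Set.Icc (-T) T, ∀ θ : ℝ,
      deriv (fun s' => deriv (fun s'' => w s'' θ) s') s
        = -deriv (fun θ' => deriv (fun θ'' => w s θ'') θ') θ - 2 / Real.cosh s ^ 2 * w s θ := by
  intro s hs θ
  have hc1 := continuous_left (contDiff_deriv_fst (contDiff_deriv_fst hw)) θ
  have hc2 := continuous_left (contDiff_deriv_snd (contDiff_deriv_snd hw)) θ
  have hc3 := continuous_left hw θ
  have hc4 : Continuous fun s => 2 / Real.cosh s ^ 2 :=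
    continuous_const.div (by fun_prop) fun s => (pow_pos (Real.cosh_pos s) 2).ne'
  have h : Set.EqOn (fun s => deriv (fun s' => deriv (fun s'' => w s'' θ) s') s)
      (fun s => -deriv (fun θ' => deriv (fun θ'' => w s θ'') θ') θ - 2 / Real.cosh s ^ 2 * w s θ)
      (Set.Ioo (-T) T) := by
    intro s hs
    have := hj s hs θ
    simp only [iteratedDeriv_succ, iteratedDeriv_zero] at this
    simp only
    linarith
  have h2 := h.closure hc1 (hc2.neg.sub (hc4.mul hc3))
  rw [closure_Ioo (by linarith)] at h2
  exact h2 hs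

/-- Fourier modes in `θ` can be differentiated in `s` under the integral sign. -/
theorem hasDerivAt_mode {w : ℝ → ℝ → ℝ} (hw : ContDiff ℝ (⊤ : ℕ∞) (uncurry w)) {e : ℝ → ℝ}
    (he : ContDiff ℝ (⊤ : ℕ∞) e) (a b s : ℝ) :
    HasDerivAt (fun s => ∫ θ in a..b, w s θ * e θ)
      (∫ θ in a..b, deriv (fun s' => w s' θ) s * e θ) s := by
  have hF : ContDiff ℝ (⊤ : ℕ∞) (uncurry fun s θ => w s θ * e θ) :=
    hw.mul (he.comp contDiff_snd)
  refine (hasDerivAt_integral_snd hF a b s).congr_deriv ?_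
  refine intervalIntegral.integral_congr fun θ _ => ?_
  exact ((hasDerivAt_fst hw s θ).mul_const (e θ)).deriv

theorem hasDerivAt_deriv_mode {T : ℝ} {w : ℝ → ℝ → ℝ} (hw : ContDiff ℝ (⊤ : ℕ∞) (uncurry w))
    (hper : ∀ s θ : ℝ, w s (θ + 2 * Real.pi) = w s θ)
    (hj : ∀ s ∈ Set.Icc (-T) T, ∀ θ : ℝ,
      deriv (fun s' => deriv (fun s'' => w s'' θ) s') s
        = -deriv (fun θ' => deriv (fun θ'' => w s θ'') θ') θ - 2 / Real.cosh s ^ 2 * w s θ)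
    {n : ℝ} {e e' : ℝ → ℝ} (he : ContDiff ℝ (⊤ : ℕ∞) e) (hde : ∀ θ, HasDerivAt e (e' θ) θ)
    (hde' : ∀ θ, HasDerivAt e' (-(n ^ 2 * e θ)) θ)
    (hep : e (2 * Real.pi) = e 0) (hep' : e' (2 * Real.pi) = e' 0)
    (s : ℝ) (hs : s ∈ Set.Icc (-T) T) :
    HasDerivAt (fun s => ∫ θ in (0 : ℝ)..(2 * Real.pi), deriv (fun s' => w s' θ) s * e θ)
      ((n ^ 2 - 2 / Real.cosh s ^ 2) * ∫ θ in (0 : ℝ)..(2 * Real.pi), w s θ * e θ) s := by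
  refine (hasDerivAt_mode (contDiff_deriv_fst hw) he _ _ s).congr_deriv ?_
  have hwθ := contDiff_deriv_snd hw
  have hc0 := continuous_right hw s
  have hc2 := continuous_right (contDiff_deriv_snd hwθ) s
  have hce := he.continuous
  have hpd : deriv (fun θ' => w s θ') (2 * Real.pi) = deriv (fun θ' => w s θ') 0 := by
    have := deriv_comp_add_const (fun θ' => w s θ') (2 * Real.pi) 0
    simp only [hper, zero_add] at this
    exact this.symm
  have hp0 : w s (2 * Real.pi) = w s 0 := by simpa using hper s 0
  have hz := integral_eq_zero_of_hasDerivAt_periodic (P := 2 * Real.pi)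
    (h := fun θ => deriv (fun θ' => w s θ') θ * e θ - w s θ * e' θ)
    (h' := fun θ => deriv (fun θ' => deriv (fun θ'' => w s θ'') θ') θ * e θ
      + n ^ 2 * (w s θ * e θ))
    (fun θ => (((hasDerivAt_snd hwθ s θ).mul (hde θ)).sub
      ((hasDerivAt_snd hw s θ).mul (hde' θ))).congr_deriv (by ring))
    (by fun_prop) (by simp only [hpd, hp0, hep, hep'])
  have hcs := continuous_right (contDiff_deriv_fst (contDiff_deriv_fst hw)) s
  rw [← sub_eq_zero, ← intervalIntegral.integral_const_mul, ← intervalIntegral.integral_sub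
    (Continuous.intervalIntegrable (by fun_prop) _ _)
    (Continuous.intervalIntegrable (by fun_prop) _ _), ← neg_eq_zero,
    ← intervalIntegral.integral_neg]
  refine (intervalIntegral.integral_congr fun θ _ => ?_).trans hz
  simp only [hj s hs θ]
  ring

/-- The index form of a Jacobi field reduces to boundary terms. -/
theorem indexForm_eq_boundary {T : ℝ} (hT : 0 < T) {w : ℝ → ℝ → ℝ}
    (hw : ContDiff ℝ (⊤ : ℕ∞) (uncurry w))
    (hper : ∀ s θ : ℝ, w s (θ + 2 * Real.pi) = w s θ)
    (hj : ∀ s ∈ Set.Icc (-T) T, ∀ θ : ℝ,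
      deriv (fun s' => deriv (fun s'' => w s'' θ) s') s
        = -deriv (fun θ' => deriv (fun θ'' => w s θ'') θ') θ - 2 / Real.cosh s ^ 2 * w s θ) :
    indexForm T w w
      = (∫ θ in (0 : ℝ)..(2 * Real.pi), w T θ * deriv (fun s' => w s' θ) T)
        - (∫ θ in (0 : ℝ)..(2 * Real.pi), w (-T) θ * deriv (fun s' => w s' θ) (-T))
        - 1 / T * ((∫ θ in (0 : ℝ)..(2 * Real.pi), w T θ * w T θ)
          + ∫ θ in (0 : ℝ)..(2 * Real.pi), w (-T) θ * w (-T) θ) := by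
  have hws := contDiff_deriv_fst hw
  have hwθ := contDiff_deriv_snd hw
  have hG : ContDiff ℝ (⊤ : ℕ∞) (uncurry fun s θ => w s θ * deriv (fun θ' => w s θ') θ) :=
    hw.mul hwθ
  have hK : ContDiff ℝ (⊤ : ℕ∞) (uncurry fun s θ => w s θ * deriv (fun s' => w s' θ) s) :=
    hw.mul hws
  have hGθ := contDiff_deriv_snd hG
  have hKs := contDiff_deriv_fst hK
  have hinner (θ : ℝ) : ∫ s in (-T)..T,
      (deriv (fun s' => w s' θ) s * deriv (fun s' => w s' θ) s
        + deriv (fun θ' => w s θ') θ * deriv (fun θ' => w s θ') θ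
        - 2 / (Real.cosh s) ^ 2 * w s θ * w s θ)
      = (w T θ * deriv (fun s' => w s' θ) T - w (-T) θ * deriv (fun s' => w s' θ) (-T))
        + ∫ s in (-T)..T, deriv (fun θ' => w s θ' * deriv (fun θ'' => w s θ'') θ') θ := by
    have hftc := intervalIntegral.integral_eq_sub_of_hasDerivAt (a := -T) (b := T)
      (fun s _ => hasDerivAt_fst hK s θ) ((continuous_left hKs θ).intervalIntegrable _ _)
    rw [← hftc, ← intervalIntegral.integral_add
      ((continuous_left hKs θ).intervalIntegrable _ _)
      ((continuous_left hGθ θ).intervalIntegrable _ _)]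
    refine intervalIntegral.integral_congr fun s hs => ?_
    rw [Set.uIcc_of_le (by linarith)] at hs
    have h1 := ((hasDerivAt_fst hw s θ).mul (hasDerivAt_fst hws s θ)).deriv
    have h2 := ((hasDerivAt_snd hw s θ).mul (hasDerivAt_snd hwθ s θ)).deriv
    simp only [Pi.mul_def] at h1 h2
    simp only [h1, h2, hj s hs θ]
    ring
  have hpd (s : ℝ) : deriv (fun θ' => w s θ') (2 * Real.pi) = deriv (fun θ' => w s θ') 0 := by
    have := deriv_comp_add_const (fun θ' => w s θ') (2 * Real.pi) 0
    simp only [hper, zero_add] at this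
    exact this.symm
  have hp0 (s : ℝ) : w s (2 * Real.pi) = w s 0 := by simpa using hper s 0
  have hcont : Continuous fun θ => ∫ s in (-T)..T,
      deriv (fun θ' => w s θ' * deriv (fun θ'' => w s θ'') θ') θ :=
    continuous_iff_continuousAt.2 fun θ =>
      (hasDerivAt_integral_snd (contDiff_uncurry_swap hGθ) (-T) T θ).continuousAt
  have hzero : ∫ θ in (0 : ℝ)..(2 * Real.pi), ∫ s in (-T)..T,
      deriv (fun θ' => w s θ' * deriv (fun θ'' => w s θ'') θ') θ = 0 :=
    integral_eq_zero_of_hasDerivAt_periodic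
      (h := fun θ => ∫ s in (-T)..T, w s θ * deriv (fun θ' => w s θ') θ)
      (fun θ => hasDerivAt_integral_snd (contDiff_uncurry_swap hG) (-T) T θ)
      hcont (by simp only [hpd, hp0])
  have hcw (s : ℝ) := continuous_right hw s
  have hcK (s : ℝ) := continuous_right hK s
  rw [indexForm, intervalIntegral.integral_congr fun θ _ => hinner θ,
    intervalIntegral.integral_add
      (Continuous.intervalIntegrable (by fun_prop) _ _)
      (hcont.intervalIntegrable _ _), hzero,
    intervalIntegral.integral_sub ((hcK T).intervalIntegrable _ _)
      ((hcK (-T)).intervalIntegrable _ _),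
    intervalIntegral.integral_add (Continuous.intervalIntegrable (by fun_prop) _ _)
      (Continuous.intervalIntegrable (by fun_prop) _ _), add_zero]

theorem integral_integral_mode_eq {w : ℝ → ℝ → ℝ} (hw : Continuous (uncurry w)) {k e : ℝ → ℝ}
    (hk : Continuous k) (he : Continuous e) (a b c d : ℝ) :
    ∫ θ in c..d, ∫ s in a..b, k s * (w s θ * e θ)
      = ∫ s in a..b, k s * ∫ θ in c..d, w s θ * e θ := by
  simp only [← intervalIntegral.integral_const_mul]
  refine MeasureTheory.intervalIntegral_intervalIntegral_swap ?_
  have hcont : Continuous (uncurry fun θ s => k s * (w s θ * e θ)) :=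
    (hk.comp continuous_snd).mul ((hw.comp (continuous_snd.prodMk continuous_fst)).mul
      (he.comp continuous_fst))
  exact (hcont.continuousOn.integrableOn_compact (isCompact_uIcc.prod isCompact_uIcc)).mono_set
    (Set.prod_mono Set.uIoc_subset_uIcc Set.uIoc_subset_uIcc)

theorem mode_boundary_nonneg {T : ℝ} (hT : 0 < T) (hTt : T * Real.tanh T = 1)
    {w : ℝ → ℝ → ℝ} (hw : ContDiff ℝ (⊤ : ℕ∞) (uncurry w))
    (hper : ∀ s θ : ℝ, w s (θ + 2 * Real.pi) = w s θ)
    (hj : ∀ s ∈ Set.Icc (-T) T, ∀ θ : ℝ,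
      deriv (fun s' => deriv (fun s'' => w s'' θ) s') s
        = -deriv (fun θ' => deriv (fun θ'' => w s θ'') θ') θ - 2 / Real.cosh s ^ 2 * w s θ)
    {n : ℤ} {e e' : ℝ → ℝ} (he : ContDiff ℝ (⊤ : ℕ∞) e) (hde : ∀ θ, HasDerivAt e (e' θ) θ)
    (hde' : ∀ θ, HasDerivAt e' (-((n : ℝ) ^ 2 * e θ)) θ)
    (hep : e (2 * Real.pi) = e 0) (hep' : e' (2 * Real.pi) = e' 0)
    (horth_zero : n = 0 →
      ∫ θ in (0 : ℝ)..(2 * Real.pi), ∫ s in (-T)..T,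
        Real.cosh s ^ 2 * Real.tanh s * (w s θ * e θ) = 0)
    (horth_one : n = 1 ∨ n = -1 →
      ∫ θ in (0 : ℝ)..(2 * Real.pi), ∫ s in (-T)..T, Real.cosh s * (w s θ * e θ) = 0) :
    0 ≤ (∫ θ in (0 : ℝ)..(2 * Real.pi), w T θ * e θ)
          * (∫ θ in (0 : ℝ)..(2 * Real.pi), deriv (fun s' => w s' θ) T * e θ)
        - (∫ θ in (0 : ℝ)..(2 * Real.pi), w (-T) θ * e θ)
          * (∫ θ in (0 : ℝ)..(2 * Real.pi), deriv (fun s' => w s' θ) (-T) * e θ)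
        - 1 / T * ((∫ θ in (0 : ℝ)..(2 * Real.pi), w T θ * e θ) ^ 2
          + (∫ θ in (0 : ℝ)..(2 * Real.pi), w (-T) θ * e θ) ^ 2) := by
  have hf := hasDerivAt_mode hw he 0 (2 * Real.pi)
  have hf' := hasDerivAt_deriv_mode hw hper hj he hde hde' hep hep'
  have htanh : Continuous Real.tanh :=
    continuous_iff_continuousAt.2 fun s => (hasDerivAt_tanh s).continuousAt
  have hn : n = 0 ∨ (n = 1 ∨ n = -1) ∨ 2 ≤ |n| := by
    rcases abs_cases n with h | h <;> omega
  rcases hn with hn | hn | hn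
  · refine boundary_nonneg_of_zero hT hTt hf (fun s hs => (hf' s hs).congr_deriv ?_) ?_
    · simp [hn]
    · rw [← integral_integral_mode_eq hw.continuous (by fun_prop) he.continuous]
      exact horth_zero hn
  · have hn2 : (n : ℝ) ^ 2 = 1 := by rcases hn with rfl | rfl <;> simp
    refine boundary_nonneg_of_one hT hTt hf (fun s hs => (hf' s hs).congr_deriv ?_) ?_
    · rw [hn2]
    · rw [← integral_integral_mode_eq hw.continuous (by fun_prop) he.continuous]
      exact horth_one hn
  · refine boundary_nonneg_of_two_le hT hTt (n := n) ?_ hf hf'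
    have h2 : (2 : ℝ) ≤ |(n : ℝ)| := by exact_mod_cast hn
    rw [← sq_abs]
    nlinarith

/-- If a smooth, `2π`-periodic in `θ` function `w` satisfies the Jacobi equation on
`(-T,T) × ℝ` and is `L²(Σ)`-orthogonal to the three components of the unit normal of
the critical catenoid, then `B(w,w) ≥ 0`. -/
theorem jacobi_fields_orthogonal_nonneg (T a : ℝ) (hT : 0 < T)
    (hTtanh : T * Real.tanh T = 1) (ha : a = 1 / (T * Real.cosh T))
    (w : ℝ → ℝ → ℝ)
    (hw_smooth : ContDiff ℝ (⊤ : ℕ∞) (Function.uncurry w))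
    (hw_per : ∀ s θ : ℝ, w s (θ + 2 * Real.pi) = w s θ)
    (hw_jacobi : ∀ s ∈ Set.Ioo (-T) T, ∀ θ : ℝ,
      iteratedDeriv 2 (fun s' => w s' θ) s + iteratedDeriv 2 (fun θ' => w s θ') θ
        + 2 / (Real.cosh s) ^ 2 * w s θ = 0)
    (horth : ∀ φ : ℝ → ℝ → ℝ,
      (φ = fun s θ => Real.cos θ / Real.cosh s) ∨
      (φ = fun s θ => Real.sin θ / Real.cosh s) ∨
      (φ = fun s _θ => Real.tanh s) →
      (∫ θ in (0:ℝ)..(2 * Real.pi), ∫ s in (-T)..T,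
          (Real.cosh s) ^ 2 * w s θ * φ s θ) = 0) :
    indexForm T w w ≥ 0 := by
  have hj := jacobi_eq_on_Icc hT hw_smooth hw_jacobi
  have hcw (s : ℝ) := continuous_right hw_smooth s
  have hcws (s : ℝ) := continuous_right (contDiff_deriv_fst hw_smooth) s
  have hdlin (n : ℤ) (θ : ℝ) : HasDerivAt (fun θ : ℝ => (n : ℝ) * θ) n θ := by
    simpa using (hasDerivAt_id θ).const_mul (n : ℝ)
  have hdcos (n : ℤ) (θ : ℝ) :
      HasDerivAt (fun θ => Real.cos (n * θ)) (-(n * Real.sin (n * θ))) θ :=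
    (hdlin n θ).cos.congr_deriv (by ring)
  have hdsin (n : ℤ) (θ : ℝ) : HasDerivAt (fun θ => Real.sin (n * θ)) (n * Real.cos (n * θ)) θ :=
    (hdlin n θ).sin.congr_deriv (by ring)
  have hpcos (n : ℤ) : Real.cos (n * (2 * Real.pi)) = Real.cos (n * 0) := by
    simp [Real.cos_int_mul_two_pi]
  have hpsin (n : ℤ) : Real.sin (n * (2 * Real.pi)) = Real.sin (n * 0) := by
    rw [show (n : ℝ) * (2 * Real.pi) = ((2 * n : ℤ) : ℝ) * Real.pi by push_cast; ring,
      Real.sin_int_mul_pi]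
    simp
  have hsech (s c x : ℝ) : Real.cosh s ^ 2 * x * (c / Real.cosh s) = Real.cosh s * (x * c) := by
    have := (Real.cosh_pos s).ne'
    field_simp
  have horth_cos := horth _ (.inl rfl)
  have horth_sin := horth _ (.inr (.inl rfl))
  have horth_tanh := horth _ (.inr (.inr rfl))
  simp only [hsech] at horth_cos horth_sin
  have hcos (n : ℤ) := mode_boundary_nonneg hT hTtanh hw_smooth hw_per hj (n := n)
    (e := fun θ => Real.cos (n * θ)) (e' := fun θ => -(n * Real.sin (n * θ)))
    (by fun_prop) (hdcos n) (fun θ => ((hdsin n θ).const_mul (n : ℝ)).neg.congr_deriv (by ring))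
    (hpcos n) (by simp only [hpsin n])
    (by
      rintro rfl
      simpa only [Int.cast_zero, zero_mul, Real.cos_zero, mul_one, mul_right_comm]
        using horth_tanh)
    (by rintro (rfl | rfl) <;> simpa using horth_cos)
  have hsin (n : ℤ) := mode_boundary_nonneg hT hTtanh hw_smooth hw_per hj (n := n)
    (e := fun θ => Real.sin (n * θ)) (e' := fun θ => n * Real.cos (n * θ))
    (by fun_prop) (hdsin n) (fun θ => ((hdcos n θ).const_mul (n : ℝ)).congr_deriv (by ring))
    (hpsin n) (by simp only [hpcos n])
    (by rintro rfl; simp)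
    (by rintro (rfl | rfl) <;> simpa using horth_sin)
  have hsum := ((hasSum_mul_cos_sin (hcw T) (hcws T)).sub
    (hasSum_mul_cos_sin (hcw (-T)) (hcws (-T)))).sub
    (((hasSum_mul_cos_sin (hcw T) (hcw T)).add
      (hasSum_mul_cos_sin (hcw (-T)) (hcw (-T)))).mul_left (1 / T))
  have hnonneg := hsum.nonneg fun n => by
    linarith [hcos n, hsin n]
  rw [indexForm_eq_boundary hT hw_smooth hw_per hj]
  refine nonneg_of_mul_nonneg_right (a := 2 * Real.pi) ?_ Real.two_pi_pos
  linarith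
end

section
/- There exists a constant C ≥ 0 such that for every smooth function u on [−T,T]×ℝ that is 2π-periodic in θ, B(u,u) + C·N₂(u) ≥ (1/2)·(∫₀^{2π}∫_{−T}^{T}((∂ₛu)² + (∂_θu)²) ds dθ + N₂(u)). -/
/-- The squared `L²` norm on the critical catenoid (conformal factor `a² cosh² s`). -/
noncomputable def catL2 (T a : ℝ) (u : ℝ → ℝ → ℝ) : ℝ :=
  a ^ 2 * ∫ θ in (0:ℝ)..(2 * Real.pi), ∫ s in (-T)..T,
    (Real.cosh s) ^ 2 * (u s θ) ^ 2

/-- Trace inequality on `[-T, T]` with explicit constants. -/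
theorem boundary_sq_le_integral {T : ℝ} (hT : 0 < T) {f f' : ℝ → ℝ}
    (hf : ∀ s, HasDerivAt f (f' s) s) (hf' : Continuous f') :
    (1 / T) * (f T * f T + f (-T) * f (-T))
      ≤ ∫ s in (-T)..T, (1 / 2 * f' s ^ 2 + 3 / T ^ 2 * f s ^ 2) := by
  have hfc : Continuous f := continuous_iff_continuousAt.2 fun s => (hf s).continuousAt
  have hderiv : ∀ s, HasDerivAt (fun s => s * f s ^ 2 / T ^ 2)
      ((f s ^ 2 + s * (2 * f s * f' s)) / T ^ 2) s := fun s => by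
    refine HasDerivAt.congr_deriv (((hasDerivAt_id s).mul ((hf s).pow 2)).div_const (T ^ 2)) ?_
    simp
  have hcont : Continuous fun s => (f s ^ 2 + s * (2 * f s * f' s)) / T ^ 2 := by fun_prop
  have hftc := intervalIntegral.integral_eq_sub_of_hasDerivAt
    (fun s _ => hderiv s) (hcont.intervalIntegrable (-T) T)
  have hbdry : (1 / T) * (f T * f T + f (-T) * f (-T))
      = T * f T ^ 2 / T ^ 2 - -T * f (-T) ^ 2 / T ^ 2 := by
    field_simp
    ring
  rw [hbdry, ← hftc]
  refine intervalIntegral.integral_mono_on (by linarith) (hcont.intervalIntegrable _ _)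
    (Continuous.intervalIntegrable (by fun_prop) _ _) fun s hs => ?_
  have hs2 : s ^ 2 ≤ T ^ 2 := sq_le_sq' hs.1 hs.2
  have hbound : f s ^ 2 + s * (2 * f s * f' s) ≤ T ^ 2 * (1 / 2 * f' s ^ 2) + 3 * f s ^ 2 := by
    nlinarith [sq_nonneg (2 * f s - s * f' s), mul_le_mul_of_nonneg_right hs2 (sq_nonneg (f' s))]
  rw [div_le_iff₀ (by positivity)]
  calc _ ≤ _ := hbound
    _ = _ := by field_simp

/-- The index form on a single meridian is coercive, uniformly in the derivative `g` in the
angular direction. -/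
theorem meridian_index_form_coercive {T a : ℝ} (hT : 0 < T) (ha : a ≠ 0) {f f' g : ℝ → ℝ}
    (hf : ∀ s, HasDerivAt f (f' s) s) (hf' : Continuous f') (hg : Continuous g) :
    (1 / 2) * ((∫ s in (-T)..T, (f' s ^ 2 + g s ^ 2))
        + a ^ 2 * ∫ s in (-T)..T, Real.cosh s ^ 2 * f s ^ 2)
      ≤ (∫ s in (-T)..T, (f' s * f' s + g s * g s - 2 / Real.cosh s ^ 2 * f s * f s))
        - (1 / T) * (f T * f T + f (-T) * f (-T))
        + ((2 + 3 / T ^ 2) / a ^ 2 + 1 / 2)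
          * (a ^ 2 * ∫ s in (-T)..T, Real.cosh s ^ 2 * f s ^ 2) := by
  have hfc : Continuous f := continuous_iff_continuousAt.2 fun s => (hf s).continuousAt
  have hcosh : ∀ s, Real.cosh s ^ 2 ≠ 0 := fun s => (pow_pos (Real.cosh_pos s) 2).ne'
  have htrace := boundary_sq_le_integral hT hf hf'
  have hdir : IntervalIntegrable (fun s => f' s ^ 2 + g s ^ 2) MeasureTheory.volume (-T) T :=
    Continuous.intervalIntegrable (by fun_prop) _ _
  have hmass : IntervalIntegrable (fun s => Real.cosh s ^ 2 * f s ^ 2) MeasureTheory.volume (-T) T :=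
    Continuous.intervalIntegrable (by fun_prop) _ _
  have htr : IntervalIntegrable (fun s => 1 / 2 * f' s ^ 2 + 3 / T ^ 2 * f s ^ 2) MeasureTheory.volume (-T) T :=
    Continuous.intervalIntegrable (by fun_prop) _ _
  have hind : IntervalIntegrable
      (fun s => f' s * f' s + g s * g s - 2 / Real.cosh s ^ 2 * f s * f s) MeasureTheory.volume (-T) T :=
    Continuous.intervalIntegrable (by fun_prop (disch := assumption)) _ _
  have hmono : ∫ s in (-T)..T, (1 / 2 * (f' s ^ 2 + g s ^ 2)
        + (1 / 2 * f' s ^ 2 + 3 / T ^ 2 * f s ^ 2))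
      ≤ ∫ s in (-T)..T, ((f' s * f' s + g s * g s - 2 / Real.cosh s ^ 2 * f s * f s)
        + (2 + 3 / T ^ 2) * (Real.cosh s ^ 2 * f s ^ 2)) := by
    refine intervalIntegral.integral_mono_on (by linarith) ((hdir.const_mul _).add htr)
      (hind.add (hmass.const_mul _)) fun s _ => ?_
    have hone : 1 ≤ Real.cosh s ^ 2 := one_le_pow₀ (Real.one_le_cosh s)
    have hpot : 2 / Real.cosh s ^ 2 * f s * f s ≤ 2 * f s ^ 2 := by
      rw [mul_assoc, ← sq]
      exact mul_le_mul_of_nonneg_right (div_le_self zero_le_two hone) (sq_nonneg _)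
    have hmul : (2 + 3 / T ^ 2) * f s ^ 2 ≤ (2 + 3 / T ^ 2) * (Real.cosh s ^ 2 * f s ^ 2) :=
      mul_le_mul_of_nonneg_left (le_mul_of_one_le_left (sq_nonneg _) hone) (by positivity)
    nlinarith [sq_nonneg (g s)]
  rw [intervalIntegral.integral_add (hdir.const_mul _) htr,
    intervalIntegral.integral_add hind (hmass.const_mul _),
    intervalIntegral.integral_const_mul, intervalIntegral.integral_const_mul] at hmono
  have hconst : ∀ N : ℝ, ((2 + 3 / T ^ 2) / a ^ 2 + 1 / 2) * (a ^ 2 * N)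
      = (2 + 3 / T ^ 2) * N + 1 / 2 * (a ^ 2 * N) := fun N => by field_simp
  rw [hconst]
  linarith

/-- Coercivity of the index form on the critical catenoid:
`B(u,u) + C·N₂(u) ≥ (1/2)(Dirichlet energy of u + N₂(u))` for some `C ≥ 0`. -/
theorem index_form_coercive (T a : ℝ) (hT : 0 < T)
    (hTtanh : T * Real.tanh T = 1) (ha : a = 1 / (T * Real.cosh T)) :
    ∃ C : ℝ, 0 ≤ C ∧
      ∀ u : ℝ → ℝ → ℝ, ContDiff ℝ (⊤ : ℕ∞) (Function.uncurry u) →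
        (∀ s θ : ℝ, u s (θ + 2 * Real.pi) = u s θ) →
        indexForm T u u + C * catL2 T a u
          ≥ (1 / 2) * ((∫ θ in (0:ℝ)..(2 * Real.pi), ∫ s in (-T)..T,
              ((deriv (fun s' => u s' θ) s) ^ 2 + (deriv (fun θ' => u s θ') θ) ^ 2))
            + catL2 T a u) := by
  have ha0 : a ≠ 0 := by
    have := Real.cosh_pos T
    rw [ha]
    positivity
  refine ⟨(2 + 3 / T ^ 2) / a ^ 2 + 1 / 2, by positivity, fun u hu _ => ?_⟩
  have hdiff : ∀ p, HasFDerivAt (Function.uncurry u) (fderiv ℝ (Function.uncurry u) p) p :=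
    fun p => (hu.differentiable (by simp) p).hasFDerivAt
  have hfd : Continuous (fderiv ℝ (Function.uncurry u)) := hu.continuous_fderiv (by simp)
  obtain ⟨p, hpc, hus⟩ : ∃ p : ℝ → ℝ → ℝ, (Continuous fun x : ℝ × ℝ => p x.1 x.2) ∧
      ∀ s θ, HasDerivAt (fun s' => u s' θ) (p s θ) s :=
    ⟨fun s θ => fderiv ℝ (Function.uncurry u) (s, θ) (1, 0), by fun_prop, fun s θ =>
      HasFDerivAt.comp_hasDerivAt (f := fun s' => (s', θ)) s (hdiff (s, θ))
        ((hasDerivAt_id s).prodMk (hasDerivAt_const s θ))⟩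
  obtain ⟨q, hqc, huθ⟩ : ∃ q : ℝ → ℝ → ℝ, (Continuous fun x : ℝ × ℝ => q x.1 x.2) ∧
      ∀ s θ, HasDerivAt (fun θ' => u s θ') (q s θ) θ :=
    ⟨fun s θ => fderiv ℝ (Function.uncurry u) (s, θ) (0, 1), by fun_prop, fun s θ =>
      HasFDerivAt.comp_hasDerivAt (f := fun θ' => (s, θ')) θ (hdiff (s, θ))
        ((hasDerivAt_const θ s).prodMk (hasDerivAt_id θ))⟩
  have huc : Continuous fun x : ℝ × ℝ => u x.1 x.2 := hu.continuous
  have hcosh : ∀ s, Real.cosh s ^ 2 ≠ 0 := fun s => (pow_pos (Real.cosh_pos s) 2).ne'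
  unfold indexForm catL2
  simp only [fun s θ => (hus s θ).deriv, fun s θ => (huθ s θ).deriv]
  have hslice : ∀ F : ℝ → ℝ → ℝ, (Continuous fun x : ℝ × ℝ => F x.1 x.2) →
      IntervalIntegrable (fun θ => ∫ s in (-T)..T, F s θ) MeasureTheory.volume 0
        (2 * Real.pi) := fun F hF =>
    (intervalIntegral.continuous_parametric_intervalIntegral_of_continuous'
      (f := fun θ s => F s θ) (hF.comp continuous_swap) (-T) T).intervalIntegrable _ _
  have huT : ∀ s, Continuous (u s) := fun s =>
    huc.comp (Continuous.prodMk continuous_const continuous_id)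
  have hdir := hslice (fun s θ => p s θ ^ 2 + q s θ ^ 2) (by fun_prop)
  have hmass := hslice (fun s θ => Real.cosh s ^ 2 * u s θ ^ 2) (by fun_prop)
  have hind := hslice (fun s θ => p s θ * p s θ + q s θ * q s θ
    - 2 / Real.cosh s ^ 2 * u s θ * u s θ) (by fun_prop (disch := exact fun _ => hcosh _))
  have hbdry : IntervalIntegrable (fun θ => u T θ * u T θ + u (-T) θ * u (-T) θ)
      MeasureTheory.volume 0 (2 * Real.pi) :=
    Continuous.intervalIntegrable (by fun_prop) _ _
  have hmono := intervalIntegral.integral_mono_on Real.two_pi_pos.le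
    ((hdir.add (hmass.const_mul (a ^ 2))).const_mul (1 / 2))
    ((hind.sub (hbdry.const_mul (1 / T))).add ((hmass.const_mul (a ^ 2)).const_mul
      ((2 + 3 / T ^ 2) / a ^ 2 + 1 / 2))) fun θ _ =>
    meridian_index_form_coercive hT ha0 (hus · θ)
      (hpc.comp (Continuous.prodMk continuous_id continuous_const))
      (hqc.comp (Continuous.prodMk continuous_id continuous_const))
  rw [intervalIntegral.integral_const_mul,
    intervalIntegral.integral_add hdir (hmass.const_mul _),
    intervalIntegral.integral_add (hind.sub (hbdry.const_mul _))
      ((hmass.const_mul _).const_mul _),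
    intervalIntegral.integral_sub hind (hbdry.const_mul _)] at hmono
  simpa only [intervalIntegral.integral_const_mul] using hmono
end
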